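/- Left compatibility of homotopy with composition: let N, N', N'' be free R-modules with finite bases (x i), (y p), (z r) and integer degree functions m, m', m'', and let δ : N → A ⊗[R] N, δ' : N' → A ⊗[R] N', δ'' : N'' → A ⊗[R] N'' be R-linear maps. Suppose φ : N' → A ⊗[R] N'' is a D-structure morphism from (N', δ') to (N'', δ'') whose coefficients f p r lie in 𝒜 (m' p − m'' r) for all p, r, and ψ, ψ' : N → A ⊗[R] N' are homotopic via H as maps from (N, δ) to (N', δ'). Then φ ∗ ψ and φ ∗ ψ' are homotopic via φ ∗ H as maps from (N, δ) to (N'', δ''): φ∗ψ − φ∗ψ' = (μ ⊗ id) ∘ (id_A ⊗ (φ∗H)) ∘ δ + (μ ⊗ id) ∘ (id_A ⊗ δ'') ∘ (φ∗H) + (d ⊗ ε_{N''}) ∘ (φ∗H). -/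

import Mathlib

open TensorProduct

noncomputable section

/-- The sign `(-1)^j` for an integer `j`. -/
def zsign (j : ℤ) : ℤ := (((-1 : ℤˣ) ^ j : ℤˣ) : ℤ)

/-- The collapse map `A ⊗ (A ⊗ M) → A ⊗ M`, i.e. `(μ ⊗ id)` after reassociation. -/
def mu2 (R A M : Type*) [CommRing R] [Ring A] [Algebra R A]
    [AddCommGroup M] [Module R M] :
    A ⊗[R] (A ⊗[R] M) →ₗ[R] A ⊗[R] M :=
  (TensorProduct.map (LinearMap.mul' R A) (LinearMap.id : M →ₗ[R] M)) ∘ₗ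
    (TensorProduct.assoc R A A M).symm.toLinearMap

/-- The composition `f ∗ g = (μ ⊗ id) ∘ (id_A ⊗ f) ∘ g` of type-D-style maps. -/
def dstar {R A : Type*} [CommRing R] [Ring A] [Algebra R A]
    {M₁ M₂ M₃ : Type*} [AddCommGroup M₁] [Module R M₁]
    [AddCommGroup M₂] [Module R M₂] [AddCommGroup M₃] [Module R M₃]
    (f : M₂ →ₗ[R] A ⊗[R] M₃) (g : M₁ →ₗ[R] A ⊗[R] M₂) :
    M₁ →ₗ[R] A ⊗[R] M₃ :=
  mu2 R A M₃ ∘ₗ LinearMap.lTensor A f ∘ₗ g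


@[simp]
theorem mu2_tmul_tmul {R A M : Type*} [CommRing R] [Ring A] [Algebra R A]
    [AddCommGroup M] [Module R M] (a b : A) (x : M) :
    mu2 R A M (a ⊗ₜ (b ⊗ₜ x)) = (a * b) ⊗ₜ x := by
  simp [mu2]

/-- The collapse map turns products in `A` into iterated collapses. -/
theorem mu2_mul_tmul {R A M : Type*} [CommRing R] [Ring A] [Algebra R A]
    [AddCommGroup M] [Module R M] (a b : A) (t : A ⊗[R] M) :
    mu2 R A M ((a * b) ⊗ₜ t) = mu2 R A M (a ⊗ₜ mu2 R A M (b ⊗ₜ t)) := by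
  induction t with
  | zero => simp
  | tmul c x => simp [mul_assoc]
  | add s t hs ht => simp [TensorProduct.tmul_add, hs, ht]

section Composition

variable {R A : Type*} [CommRing R] [Ring A] [Algebra R A]
  {M₁ M₂ M₃ M₄ : Type*} [AddCommGroup M₁] [Module R M₁] [AddCommGroup M₂] [Module R M₂]
  [AddCommGroup M₃] [Module R M₃] [AddCommGroup M₄] [Module R M₄]

theorem dstar_assoc (h : M₃ →ₗ[R] A ⊗[R] M₄) (g : M₂ →ₗ[R] A ⊗[R] M₃)
    (f : M₁ →ₗ[R] A ⊗[R] M₂) :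
    dstar (dstar h g) f = dstar h (dstar g f) := by
  have key (a : A) (t : A ⊗[R] M₃) :
      mu2 R A M₄ (a ⊗ₜ mu2 R A M₄ (LinearMap.lTensor A h t)) =
        mu2 R A M₄ (LinearMap.lTensor A h (mu2 R A M₃ (a ⊗ₜ t))) := by
    induction t with
    | zero => simp
    | tmul b x => simp [mu2_mul_tmul]
    | add s t hs ht => simp [TensorProduct.tmul_add, hs, ht]
  ext u
  simp only [dstar, LinearMap.comp_apply]
  induction f u with
  | zero => simp
  | tmul a x => simp [key]
  | add s t hs ht => simp only [map_add, hs, ht]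

theorem dstar_add_right (g : M₂ →ₗ[R] A ⊗[R] M₃) (f f' : M₁ →ₗ[R] A ⊗[R] M₂) :
    dstar g (f + f') = dstar g f + dstar g f' := by
  simp [dstar, LinearMap.comp_add]

theorem dstar_sub_right (g : M₂ →ₗ[R] A ⊗[R] M₃) (f f' : M₁ →ₗ[R] A ⊗[R] M₂) :
    dstar g (f - f') = dstar g f - dstar g f' := by
  simp [dstar, LinearMap.comp_sub]

theorem dstar_sub_left (g g' : M₂ →ₗ[R] A ⊗[R] M₃) (f : M₁ →ₗ[R] A ⊗[R] M₂) :
    dstar (g - g') f = dstar g f - dstar g' f := by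
  simp [dstar, LinearMap.lTensor_sub, LinearMap.comp_sub, LinearMap.sub_comp]

end Composition

theorem zsign_mul_zsign_sub (i j : ℤ) : zsign j * zsign (i - j) = zsign i := by
  simp only [zsign, ← Units.val_mul, ← zpow_add, add_sub_cancel]

/-- The signed Leibniz rule for `d ⊗ ε` with respect to `∗`. -/
theorem map_comp_dstar {R A : Type*} [CommRing R] [Ring A] [Algebra R A]
    (𝒜 : ℤ → Submodule R A) (d : A →ₗ[R] A)
    (hLeib : ∀ (j : ℤ) (α β : A), β ∈ 𝒜 j →
      d (α * β) = zsign j • (d α * β) + α * d β)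
    {M M' M'' ι' ι'' : Type*} [AddCommGroup M] [Module R M]
    [AddCommGroup M'] [Module R M'] [AddCommGroup M''] [Module R M''] [Fintype ι'']
    (v : Module.Basis ι' R M') (w : ι'' → M'') (m' : ι' → ℤ) (m'' : ι'' → ℤ)
    (ε' : M' →ₗ[R] M') (hε' : ∀ p, ε' (v p) = zsign (m' p) • v p)
    (ε'' : M'' →ₗ[R] M'') (hε'' : ∀ r, ε'' (w r) = zsign (m'' r) • w r)
    (φ : M' →ₗ[R] A ⊗[R] M'') (f : ι' → ι'' → A)
    (hf : ∀ p, φ (v p) = ∑ r, f p r ⊗ₜ[R] w r)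
    (hfdeg : ∀ p r, f p r ∈ 𝒜 (m' p - m'' r))
    (H : M →ₗ[R] A ⊗[R] M') :
    TensorProduct.map d ε'' ∘ₗ dstar φ H =
      dstar φ (TensorProduct.map d ε' ∘ₗ H) + dstar (TensorProduct.map d ε'' ∘ₗ φ) H := by
  have key : TensorProduct.map d ε'' ∘ₗ mu2 R A M'' ∘ₗ LinearMap.lTensor A φ =
      mu2 R A M'' ∘ₗ LinearMap.lTensor A φ ∘ₗ TensorProduct.map d ε' +
        mu2 R A M'' ∘ₗ LinearMap.lTensor A (TensorProduct.map d ε'' ∘ₗ φ) := by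
    refine TensorProduct.ext (LinearMap.ext fun a => v.ext fun p => ?_)
    simp only [LinearMap.compr₂ₛₗ_apply, TensorProduct.mk_apply, LinearMap.comp_apply,
      LinearMap.add_apply, LinearMap.lTensor_tmul, TensorProduct.map_tmul, hf, hε', map_zsmul,
      TensorProduct.tmul_smul, TensorProduct.tmul_sum, map_sum, mu2_tmul_tmul, hε'',
      Finset.smul_sum, ← Finset.sum_add_distrib]
    refine Finset.sum_congr rfl fun r _ => ?_
    rw [hLeib _ _ _ (hfdeg p r), TensorProduct.add_tmul, smul_add, ← TensorProduct.smul_tmul',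
      smul_smul, zsign_mul_zsign_sub]
  simpa only [dstar, LinearMap.comp_assoc, LinearMap.add_comp] using
    congrArg (fun F => F ∘ₗ H) key

/-- left compatibility of homotopy with composition: if `φ` is a
`D`-structure morphism from `(N', δ')` to `(N'', δ'')` with coefficients
`f p r ∈ 𝒜 (m' p − m'' r)`, and `ψ ≃_H ψ'` as maps from `(N, δ)` to `(N', δ')`,
then `φ ∗ ψ ≃_{φ ∗ H} φ ∗ ψ'` as maps from `(N, δ)` to `(N'', δ'')`. -/
theorem homotopy_comp_left
    {R A : Type*} [CommRing R] [Ring A] [Algebra R A]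
    (𝒜 : ℤ → Submodule R A) [GradedAlgebra 𝒜]
    (d : A →ₗ[R] A) (hd1 : d 1 = 0)
    (hLeib : ∀ (j : ℤ) (α β : A), β ∈ 𝒜 j →
      d (α * β) = zsign j • (d α * β) + α * d β)
    {ι ι' ι'' : Type*} [Fintype ι] [DecidableEq ι] [Fintype ι'] [DecidableEq ι']
    [Fintype ι''] [DecidableEq ι'']
    (m : ι → ℤ) (m' : ι' → ℤ) (m'' : ι'' → ℤ)
    (δ : (ι → R) →ₗ[R] A ⊗[R] (ι → R))
    (δ' : (ι' → R) →ₗ[R] A ⊗[R] (ι' → R))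
    (δ'' : (ι'' → R) →ₗ[R] A ⊗[R] (ι'' → R))
    (ε' : (ι' → R) →ₗ[R] (ι' → R))
    (hε' : ∀ p, ε' (Pi.basisFun R ι' p) =
      zsign (m' p) • (Pi.basisFun R ι' p : ι' → R))
    (ε'' : (ι'' → R) →ₗ[R] (ι'' → R))
    (hε'' : ∀ r, ε'' (Pi.basisFun R ι'' r) =
      zsign (m'' r) • (Pi.basisFun R ι'' r : ι'' → R))
    (φ : (ι' → R) →ₗ[R] A ⊗[R] (ι'' → R))
    (hφ : dstar δ'' φ - dstar φ δ' + (TensorProduct.map d ε'') ∘ₗ φ = 0)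
    (f : ι' → ι'' → A)
    (hf : ∀ p, φ (Pi.basisFun R ι' p) =
      ∑ r, f p r ⊗ₜ[R] (Pi.basisFun R ι'' r : ι'' → R))
    (hfdeg : ∀ p r, f p r ∈ 𝒜 (m' p - m'' r))
    (ψ ψ' H : (ι → R) →ₗ[R] A ⊗[R] (ι' → R))
    (hHom : ψ - ψ' =
      dstar H δ + dstar δ' H + (TensorProduct.map d ε') ∘ₗ H) :
    dstar φ ψ - dstar φ ψ' =
      dstar (dstar φ H) δ + dstar δ'' (dstar φ H)
        + (TensorProduct.map d ε'') ∘ₗ dstar φ H := by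
  have hφ' : dstar δ'' φ = dstar φ δ' - TensorProduct.map d ε'' ∘ₗ φ := by
    rw [← sub_eq_zero, ← hφ]
    abel
  rw [← dstar_sub_right, hHom, dstar_add_right, dstar_add_right, dstar_assoc,
    ← dstar_assoc δ'', hφ', dstar_sub_left, dstar_assoc φ δ',
    map_comp_dstar 𝒜 d hLeib (Pi.basisFun R ι') (Pi.basisFun R ι'') m' m'' ε' hε' ε'' hε''
      φ f hf hfdeg H]
  abel

end
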